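/- Let G = K(m, 2) for m ≥ 5 and let D be any target distribution on G of size t ≥ 1. Then π(G, D) ≤ π_t(G); that is, the Target Conjecture holds for the Kneser graphs K(m, 2). -/

import Mathlib

/-- A single pebbling step: remove two pebbles from `u` and add one to an adjacent `v`. -/
def PebblingStep {V : Type} [DecidableEq V] (G : SimpleGraph V) (C C' : V → ℕ) : Prop :=
  ∃ u v : V, G.Adj u v ∧ 2 ≤ C u ∧
    C' = fun w => if w = u then C u - 2 else if w = v then C v + 1 else C w

/-- `C` solves the target distribution `D`: some sequence of pebbling steps reaches a
configuration with at least `D v` pebbles on each vertex `v`. -/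
def Solvable {V : Type} [DecidableEq V] (G : SimpleGraph V) (C D : V → ℕ) : Prop :=
  ∃ C' : V → ℕ, Relation.ReflTransGen (PebblingStep G) C C' ∧ ∀ v, D v ≤ C' v

/-- The distribution with `t` pebbles stacked on `r` and none elsewhere. -/
def stack {V : Type} [DecidableEq V] (r : V) (t : ℕ) : V → ℕ :=
  fun v => if v = r then t else 0

/-- The pebbling number of the demand `D` in `G`: the smallest `m` such that every
configuration of size `m` is `D`-solvable. -/
noncomputable def pebblingNumber {V : Type} [Fintype V] [DecidableEq V] (G : SimpleGraph V) (D : V → ℕ) : ℕ :=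
  sInf {m | ∀ C : V → ℕ, (∑ v, C v) = m → Solvable G C D}

/-- The `t`-fold pebbling number of `G`. -/
noncomputable def tPebblingNumber {V : Type} [Fintype V] [DecidableEq V]
    (G : SimpleGraph V) (t : ℕ) : ℕ :=
  Finset.univ.sup fun r => pebblingNumber G (stack r t)

/-- Reaching `C'` from `C` by exactly `k` pebbling steps. -/
inductive StepsN {V : Type} [DecidableEq V] (G : SimpleGraph V) : ℕ → (V → ℕ) → (V → ℕ) → Prop
  | refl (C : V → ℕ) : StepsN G 0 C C
  | tail {k : ℕ} {C C' C'' : V → ℕ} :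
      StepsN G k C C' → PebblingStep G C' C'' → StepsN G (k + 1) C C''

/-- `C` has an `r`-solution of cost at most `c` (cost = number of pebbling steps plus one). -/
def CheaplySolvable {V : Type} [DecidableEq V] (G : SimpleGraph V) (C : V → ℕ) (r : V) (c : ℕ) : Prop :=
  ∃ (k : ℕ) (C' : V → ℕ), StepsN G k C C' ∧ 1 ≤ C' r ∧ k + 1 ≤ c

/-- The eccentricity of a vertex: the maximum distance to any other vertex. -/
noncomputable def eccentricity {V : Type} [Fintype V] (G : SimpleGraph V) (r : V) : ℕ :=
  Finset.univ.sup fun v => G.dist r v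

/-- A vertex is simplicial if its neighborhood induces a complete graph. -/
def IsSimplicial {V : Type} (G : SimpleGraph V) (v : V) : Prop :=
  ∀ a b : V, G.Adj v a → G.Adj v b → a ≠ b → G.Adj a b

/-- A 2-path is either `K₂` or `K₃`, or a graph with exactly two simplicial vertices
`u` and `v` such that the neighborhood of `v` induces `K₂` and `G - v` is a 2-path. -/
inductive IsTwoPath : {V : Type} → SimpleGraph V → Prop
  | complete2 {V : Type} (G : SimpleGraph V) :
      Nat.card V = 2 → (∀ a b : V, a ≠ b → G.Adj a b) → IsTwoPath G
  | complete3 {V : Type} (G : SimpleGraph V) :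
      Nat.card V = 3 → (∀ a b : V, a ≠ b → G.Adj a b) → IsTwoPath G
  | extend {V : Type} (G : SimpleGraph V) (u v : V) :
      u ≠ v →
      {w : V | IsSimplicial G w} = {u, v} →
      (G.neighborSet v).ncard = 2 →
      IsSimplicial G v →
      IsTwoPath (G.induce {w : V | w ≠ v}) →
      IsTwoPath G

/-- The Kneser graph `K(m, h)`: vertices are the `h`-element subsets of `{1, …, m}`,
adjacent iff disjoint. -/
def kneserGraph (m h : ℕ) : SimpleGraph {s : Finset (Fin m) // s.card = h} :=
  SimpleGraph.fromRel fun a b => Disjoint a.1 b.1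


section PebblingCalculus

variable {V : Type} [DecidableEq V] {G : SimpleGraph V}

lemma PebblingStep.add_right {C C' : V → ℕ} (h : PebblingStep G C C') (E : V → ℕ) :
    PebblingStep G (C + E) (C' + E) := by
  obtain ⟨u, v, huv, hu, rfl⟩ := h
  refine ⟨u, v, huv, by simp; omega, ?_⟩
  funext w
  simp only [Pi.add_apply]
  split_ifs <;> subst_vars <;> omega

lemma reachable_add_right {C C' : V → ℕ} (h : Relation.ReflTransGen (PebblingStep G) C C')
    (E : V → ℕ) : Relation.ReflTransGen (PebblingStep G) (C + E) (C' + E) :=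
  h.lift (· + E) fun _ _ hs => hs.add_right E

lemma solvable_of_le {C D : V → ℕ} (h : D ≤ C) : Solvable G C D :=
  ⟨C, .refl, h⟩

lemma Solvable.trans {C D E : V → ℕ} (h₁ : Solvable G C D) (h₂ : Solvable G D E) :
    Solvable G C E := by
  obtain ⟨C', hC, hD⟩ := h₁
  obtain ⟨D', hD', hE⟩ := h₂
  have hsplit : D + (C' - D) = C' := funext fun v => Nat.add_sub_cancel' (hD v)
  have hreach := reachable_add_right hD' (C' - D)
  rw [hsplit] at hreach
  exact ⟨_, hC.trans hreach, fun v => (hE v).trans (Nat.le_add_right _ _)⟩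

lemma Solvable.add_right {C D : V → ℕ} (h : Solvable G C D) (E : V → ℕ) :
    Solvable G (C + E) (D + E) := by
  obtain ⟨C', hC, hD⟩ := h
  exact ⟨_, reachable_add_right hC E, fun v => Nat.add_le_add_right (hD v) _⟩

lemma Solvable.add {C D C' D' : V → ℕ} (h : Solvable G C D) (h' : Solvable G C' D') :
    Solvable G (C + C') (D + D') := by
  refine (h.add_right C').trans ?_
  rw [add_comm D, add_comm D]
  exact h'.add_right D

lemma solvable_single {u v : V} (h : G.Adj u v) (k : ℕ) :
    Solvable G (Pi.single u (2 * k)) (Pi.single v k) := by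
  induction k with
  | zero => exact solvable_of_le (by simp)
  | succ k ih =>
    have hone : Solvable G (Pi.single u 2) (Pi.single v 1) := by
      refine ⟨_, .single ⟨u, v, h, by simp, rfl⟩, fun w => ?_⟩
      have := h.ne
      by_cases hw : w = v
      · subst hw; simp [this.symm]
      · simp [hw]
    have := ih.add hone
    rwa [← Pi.single_add, ← Pi.single_add] at this

/-- One pebble is moved along `v → u` and the pair so formed is moved on to `w`. -/
lemma solvable_relay {v u w : V} (hvu : G.Adj v u) (huw : G.Adj u w) :
    Solvable G (Pi.single v 2 + Pi.single u 1) (Pi.single w 1) := by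
  have h := (solvable_single hvu 1).add_right (Pi.single u 1)
  rw [← Pi.single_add] at h
  exact h.trans (solvable_single huw 1)

/-- Pairs on `v` and `v'` are both moved to `u`, and the pair so formed is moved on to `w`. -/
lemma solvable_join {v v' u w : V} (h : G.Adj v u) (h' : G.Adj v' u) (huw : G.Adj u w) :
    Solvable G (Pi.single v 2 + Pi.single v' 2) (Pi.single w 1) := by
  have h := (solvable_single h 1).add (solvable_single h' 1)
  rw [← Pi.single_add] at h
  exact h.trans (solvable_single huw 1)

lemma solvable_of_adj {w r : V} (h : G.Adj w r) :
    Solvable G (Pi.single w 1 + Pi.single w 1) (Pi.single r 1) := by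
  rw [← Pi.single_add]
  exact solvable_single h 1

lemma solvable_relay_relay {v u w r : V} (hvu : G.Adj v u) (huw : G.Adj u w) (hwr : G.Adj w r) :
    Solvable G (Pi.single v 2 + Pi.single u 1 + Pi.single w 1) (Pi.single r 1) :=
  ((solvable_relay hvu huw).add_right _).trans (solvable_of_adj hwr)

lemma solvable_relay_join {v u w v' r : V} (hvu : G.Adj v u) (huw : G.Adj u w)
    (hv'w : G.Adj v' w) (hwr : G.Adj w r) :
    Solvable G (Pi.single v 2 + Pi.single v' 2 + Pi.single u 1) (Pi.single r 1) := by
  rw [add_right_comm]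
  exact ((solvable_relay hvu huw).add (solvable_single hv'w 1)).trans (solvable_of_adj hwr)

lemma solvable_join_relay {v v' u w r : V} (h : G.Adj v u) (h' : G.Adj v' u) (huw : G.Adj u w)
    (hwr : G.Adj w r) :
    Solvable G (Pi.single v 2 + Pi.single v' 2 + Pi.single w 1) (Pi.single r 1) :=
  ((solvable_join h h' huw).add_right _).trans (solvable_of_adj hwr)

lemma solvable_join_join {v v' u w v'' r : V} (h : G.Adj v u) (h' : G.Adj v' u) (huw : G.Adj u w)
    (h'' : G.Adj v'' w) (hwr : G.Adj w r) :
    Solvable G (Pi.single v 2 + Pi.single v'' 2 + Pi.single v' 2) (Pi.single r 1) := by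
  rw [add_right_comm]
  exact ((solvable_join h h' huw).add (solvable_single h'' 1)).trans (solvable_of_adj hwr)

lemma solvable_single_four {u w r : V} (huw : G.Adj u w) (hwr : G.Adj w r) :
    Solvable G (Pi.single u 4) (Pi.single r 1) :=
  (solvable_single huw 2).trans (solvable_single hwr 1)

lemma solvable_two_three {v u w r : V} (hvu : G.Adj v u) (huw : G.Adj u w) (hwr : G.Adj w r) :
    Solvable G (Pi.single v 2 + Pi.single u 3) (Pi.single r 1) := by
  have h := (solvable_single hvu 1).add_right (Pi.single u 3)
  rw [← Pi.single_add] at h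
  exact h.trans (solvable_single_four huw hwr)

lemma solvable_two_two_two {v v' u w r : V} (h : G.Adj v u) (h' : G.Adj v' u) (huw : G.Adj u w)
    (hwr : G.Adj w r) :
    Solvable G (Pi.single v 2 + Pi.single v' 2 + Pi.single u 2) (Pi.single r 1) := by
  have h := ((solvable_single h 1).add (solvable_single h' 1)).add_right (Pi.single u 2)
  rw [← Pi.single_add, ← Pi.single_add] at h
  exact h.trans (solvable_single_four huw hwr)

/-- Serve one unit of the demand with `E` and the rest with what remains. -/
lemma solvable_of_deliver {C D E : V → ℕ} {r : V} (hE : E ≤ C)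
    (hr : Solvable G E (Pi.single r 1)) (hD : 1 ≤ D r)
    (h : Solvable G (C - E) (D - Pi.single r 1)) : Solvable G C D := by
  have h := h.add hr
  rw [tsub_add_cancel_of_le hE, tsub_add_cancel_of_le] at h
  · exact h
  · intro x
    by_cases hx : x = r
    · subst hx; simpa
    · simp [hx]

lemma single_le_config {C : V → ℕ} {u : V} {i : ℕ} (hi : i ≤ C u) : Pi.single u i ≤ C := by
  intro x
  by_cases hx : x = u
  · subst hx; simpa
  · simp [hx]

lemma single_add_single_le {C : V → ℕ} {u v : V} {i j : ℕ} (huv : u ≠ v)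
    (hi : i ≤ C u) (hj : j ≤ C v) : Pi.single u i + Pi.single v j ≤ C := by
  intro x
  by_cases hx : x = u
  · subst hx; simpa [huv]
  · by_cases hx' : x = v
    · subst hx'; simpa [hx]
    · simp [hx, hx']

lemma single_add_single_add_single_le {C : V → ℕ} {u v w : V} {i j k : ℕ}
    (huv : u ≠ v) (huw : u ≠ w) (hvw : v ≠ w) (hi : i ≤ C u) (hj : j ≤ C v) (hk : k ≤ C w) :
    Pi.single u i + Pi.single v j + Pi.single w k ≤ C := by
  intro x
  by_cases hx : x = u
  · subst hx; simpa [huv, huw]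
  · by_cases hx' : x = v
    · subst hx'; simpa [hx, hvw]
    · by_cases hx'' : x = w
      · subst hx''; simpa [hx, hx']
      · simp [hx, hx', hx'']

lemma lt_of_unsolvable_single {C : V → ℕ} {r v : V} {k : ℕ}
    (h : ∀ E ≤ C, ¬ Solvable G E (Pi.single r 1))
    (hs : Solvable G (Pi.single v k) (Pi.single r 1)) : C v < k :=
  not_le.mp fun hk => h _ (single_le_config hk) hs

lemma lt_of_unsolvable_pair {C : V → ℕ} {r u v : V} {j k : ℕ}
    (h : ∀ E ≤ C, ¬ Solvable G E (Pi.single r 1)) (hu : j ≤ C u)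
    (hs : Solvable G (Pi.single u j + Pi.single v k) (Pi.single r 1)) (huv : u ≠ v) : C v < k :=
  not_le.mp fun hk => h _ (single_add_single_le huv hu hk) hs

lemma lt_of_unsolvable_triple {C : V → ℕ} {r u v w : V} {i j k : ℕ}
    (h : ∀ E ≤ C, ¬ Solvable G E (Pi.single r 1)) (hu : i ≤ C u) (hv : j ≤ C v)
    (hs : Solvable G (Pi.single u i + Pi.single v j + Pi.single w k) (Pi.single r 1))
    (huv : u ≠ v) (huw : u ≠ w) (hvw : v ≠ w) : C w < k :=
  not_le.mp fun hk => h _ (single_add_single_add_single_le huv huw hvw hu hv hk) hs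

end PebblingCalculus

section LowerBound

variable {V : Type} [Fintype V] [DecidableEq V] {G : SimpleGraph V}

lemma sum_update_two_le {u v : V} (huv : u ≠ v) {f f' : V → ℕ}
    (h : ∀ w, w ≠ u → w ≠ v → f' w = f w) (hle : f' u + f' v ≤ f u + f v) :
    ∑ w, f' w ≤ ∑ w, f w := by
  have hv : v ∈ Finset.univ.erase u := by simp [huv.symm]
  rw [← Finset.add_sum_erase _ f (Finset.mem_univ u), ← Finset.add_sum_erase _ f' (Finset.mem_univ u),
    ← Finset.add_sum_erase _ f hv, ← Finset.add_sum_erase _ f' hv]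
  have : ∑ w ∈ (Finset.univ.erase u).erase v, f' w = ∑ w ∈ (Finset.univ.erase u).erase v, f w :=
    Finset.sum_congr rfl fun w hw => by
      simp only [Finset.mem_erase] at hw
      exact h w hw.2.1 hw.1
  omega

/-- A weight that no pebbling step increases bounds what can be gathered on `r`. -/
lemma not_solvable_stack_of_weight {g : V → ℕ → ℕ} {C C₀ : V → ℕ} {r : V} {t : ℕ}
    (hmono : ∀ v, Monotone (g v))
    (hstep : ∀ u v, G.Adj u v → ∀ c d, g u c + g v (d + 1) ≤ g u (c + 2) + g v d)
    (hC : C ≤ C₀) (hlt : ∑ v, g v (C₀ v) < g r t) : ¬ Solvable G C (stack r t) := by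
  rintro ⟨C', hreach, hC'⟩
  have hmain : ∑ v, g v (C' v) ≤ ∑ v, g v (C v) := by
    clear hC'
    induction hreach with
    | refl => exact le_rfl
    | tail _ hs ih =>
      obtain ⟨u, v, huv, hu, rfl⟩ := hs
      obtain ⟨c, hc⟩ := Nat.exists_eq_add_of_le' hu
      refine (sum_update_two_le huv.ne (fun w hwu hwv => by simp [hwu, hwv]) ?_).trans ih
      simpa [huv.ne.symm, hc] using hstep u v huv c _
  have h₁ : g r t ≤ g r (C' r) := hmono r (by simpa [stack] using hC' r)
  have h₂ : g r (C' r) ≤ ∑ v, g v (C' v) :=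
    Finset.single_le_sum (f := fun v => g v (C' v)) (fun _ _ => Nat.zero_le _) (Finset.mem_univ r)
  have h₃ : ∑ v, g v (C v) ≤ ∑ v, g v (C₀ v) := Finset.sum_le_sum fun v _ => hmono v (hC v)
  omega

lemma sum_sub_single {C : V → ℕ} {v : V} (hv : 1 ≤ C v) :
    ∑ x, (C - Pi.single v 1 : V → ℕ) x + 1 = ∑ x, C x := by
  conv_rhs => rw [← tsub_add_cancel_of_le (single_le_config hv)]
  simp [Finset.sum_add_distrib]

lemma exists_le_sum_eq (C₀ : V → ℕ) {k : ℕ} (hk : k ≤ ∑ v, C₀ v) :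
    ∃ C ≤ C₀, ∑ v, C v = k := by
  induction hs : ∑ v, C₀ v generalizing C₀ with
  | zero => exact ⟨C₀, le_rfl, by omega⟩
  | succ s ih =>
    rcases eq_or_lt_of_le hk with h | h
    · exact ⟨C₀, le_rfl, h.symm⟩
    · obtain ⟨v, -, hv⟩ := Finset.exists_ne_zero_of_sum_ne_zero (by omega : ∑ v, C₀ v ≠ 0)
      have hsum := sum_sub_single (C := C₀) (v := v) (by omega)
      obtain ⟨C, hC, hCk⟩ := ih (C₀ - Pi.single v 1) (by omega) (by omega)
      exact ⟨C, hC.trans tsub_le_self, hCk⟩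

lemma lt_pebblingNumber_of_forall_le {D C₀ : V → ℕ} {L : ℕ}
    (hL : ∀ C : V → ℕ, ∑ v, C v = L → Solvable G C D)
    (hC₀ : ∀ C ≤ C₀, ¬ Solvable G C D) : ∑ v, C₀ v < pebblingNumber G D := by
  by_contra! hle
  obtain ⟨C, hC, hsum⟩ := exists_le_sum_eq C₀ hle
  exact hC₀ C hC (Nat.sInf_mem (s := {m | ∀ C : V → ℕ, (∑ v, C v) = m → Solvable G C D})
    ⟨L, hL⟩ C hsum)

end LowerBound

section Kneser

variable {m : ℕ}

lemma kneserGraph_two_adj {x y : {s : Finset (Fin m) // s.card = 2}} :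
    (kneserGraph m 2).Adj x y ↔ Disjoint x.1 y.1 := by
  simp only [kneserGraph, SimpleGraph.fromRel_adj]
  refine ⟨fun h => h.2.elim id fun h => h.symm, fun h => ⟨?_, .inl h⟩⟩
  rintro rfl
  have := x.2
  simp_all

/-- The vertex `{a, b}` of `K(m, 2)`. -/
def pairVertex (a b : Fin m) (h : a ≠ b) : {s : Finset (Fin m) // s.card = 2} :=
  ⟨{a, b}, Finset.card_pair h⟩

lemma pairVertex_adj {a b c d : Fin m} {h : a ≠ b} {h' : c ≠ d} :
    (kneserGraph m 2).Adj (pairVertex a b h) (pairVertex c d h') ↔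
      a ≠ c ∧ a ≠ d ∧ b ≠ c ∧ b ≠ d := by
  rw [kneserGraph_two_adj]
  simp [pairVertex, eq_comm]
  tauto

lemma pairVertex_inj {a b c d : Fin m} {h : a ≠ b} {h' : c ≠ d} :
    pairVertex a b h = pairVertex c d h' ↔ a = c ∧ b = d ∨ a = d ∧ b = c := by
  rw [pairVertex, pairVertex, Subtype.mk.injEq, ← Finset.coe_inj]
  simp [Set.pair_eq_pair_iff]

lemma pairVertex_comm {a b : Fin m} (h : a ≠ b) : pairVertex a b h = pairVertex b a h.symm :=
  Subtype.ext (Finset.pair_comm a b)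

lemma exists_pairVertex (v : {s : Finset (Fin m) // s.card = 2}) {a : Fin m} (ha : a ∈ v.1) :
    ∃ (b : Fin m) (h : a ≠ b), v = pairVertex a b h := by
  obtain ⟨x, y, hxy, hv⟩ := Finset.card_eq_two.mp v.2
  rw [hv] at ha
  simp only [Finset.mem_insert, Finset.mem_singleton] at ha
  rcases ha with rfl | rfl
  · exact ⟨y, hxy, Subtype.ext hv⟩
  · exact ⟨x, hxy.symm, Subtype.ext (hv.trans (Finset.pair_comm _ _))⟩

lemma exists_pairVertex_pairVertex {r v : {s : Finset (Fin m) // s.card = 2}} (hne : v ≠ r)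
    (hadj : ¬ (kneserGraph m 2).Adj v r) :
    ∃ (a b c : Fin m) (hab : a ≠ b) (hac : a ≠ c), b ≠ c ∧
      r = pairVertex a b hab ∧ v = pairVertex a c hac := by
  rw [kneserGraph_two_adj, Finset.not_disjoint_iff] at hadj
  obtain ⟨a, hav, har⟩ := hadj
  obtain ⟨b, hab, rfl⟩ := exists_pairVertex r har
  obtain ⟨c, hac, rfl⟩ := exists_pairVertex v hav
  refine ⟨a, b, c, hab, hac, ?_, rfl, rfl⟩
  rintro rfl
  exact hne rfl

lemma exists_pairVertex_of_card {s : Finset (Fin m)} (hs : s.card + 2 ≤ m) :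
    ∃ v : {s : Finset (Fin m) // s.card = 2}, Disjoint v.1 s := by
  have hcard : 2 ≤ sᶜ.card := by
    rw [Finset.card_compl, Fintype.card_fin]; omega
  obtain ⟨w, hw, hw2⟩ := Finset.exists_subset_card_eq hcard
  exact ⟨⟨w, hw2⟩, Finset.disjoint_of_subset_left hw disjoint_compl_left⟩

lemma card_add_card_le_of_forall_eq {α : Type*} [DecidableEq α] {X Y W : Finset α}
    (hX : X ⊆ W) (hY : Y ⊆ W) (hW : 2 ≤ W.card) (h : ∀ x ∈ X, ∀ y ∈ Y, x = y) :
    X.card + Y.card ≤ W.card := by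
  rcases X.eq_empty_or_nonempty with rfl | ⟨x, hx⟩
  · simpa using Finset.card_le_card hY
  rcases Y.eq_empty_or_nonempty with rfl | ⟨y, hy⟩
  · simpa using Finset.card_le_card hX
  have hX1 : X.card ≤ 1 := Finset.card_le_one.mpr fun a ha b hb => (h a ha y hy).trans (h b hb y hy).symm
  have hY1 : Y.card ≤ 1 := Finset.card_le_one.mpr fun a ha b hb => (h x hx a ha).symm.trans (h x hx b hb)
  omega

/-- If no pair on `v` can be turned into a pebble on `r` with the help of single pebbles on one or
two further vertices, then few vertices carry an odd number of pebbles. -/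
lemma card_odd_le (hm : 5 ≤ m) {C : {s : Finset (Fin m) // s.card = 2} → ℕ}
    {r v : {s : Finset (Fin m) // s.card = 2}} (hne : v ≠ r)
    (hadj : ¬ (kneserGraph m 2).Adj v r) (hr : C r = 0)
    (hone : ∀ w, (kneserGraph m 2).Adj v w → (kneserGraph m 2).Adj w r → C w = 0)
    (htwo : ∀ u w, (kneserGraph m 2).Adj v u → (kneserGraph m 2).Adj u w →
      (kneserGraph m 2).Adj w r → C u % 2 = 1 → C w % 2 = 1 → False) :
    (Finset.univ.filter fun x => C x % 2 = 1).card + 4 ≤ 2 * m := by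
  obtain ⟨a, b, c, hab, hac, hbc, rfl, rfl⟩ := exists_pairVertex_pairVertex hne hadj
  set O := (Finset.univ.filter fun x => C x % 2 = 1).image Subtype.val with hO
  have hOcard : O.card = (Finset.univ.filter fun x => C x % 2 = 1).card :=
    Finset.card_image_of_injective _ Subtype.val_injective
  have hmem : ∀ s, s ∈ O ↔ ∃ h : s.card = 2, C ⟨s, h⟩ % 2 = 1 := by
    intro s
    simp [hO, and_comm]
  set W : Finset (Fin m) := Finset.univ \ {a, b, c} with hWdef
  have hW : W.card = m - 3 := by
    rw [hWdef, Finset.card_univ_sdiff, Finset.card_eq_three.mpr ⟨a, b, c, hab, hac, hbc, rfl⟩,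
      Fintype.card_fin]
  have hWmem : ∀ x, x ∈ W ↔ x ≠ a ∧ x ≠ b ∧ x ≠ c := by
    intro x
    simp [hWdef]
  set X := W.filter fun x => {b, x} ∈ O with hX
  set Y := W.filter fun y => {c, y} ∈ O with hY
  have hXY : X.card + Y.card ≤ W.card := by
    refine card_add_card_le_of_forall_eq (Finset.filter_subset _ _) (Finset.filter_subset _ _)
      (by omega) fun x hx y hy => ?_
    rw [hX, Finset.mem_filter, hWmem, hmem] at hx
    rw [hY, Finset.mem_filter, hWmem, hmem] at hy
    obtain ⟨⟨hxa, hxb, hxc⟩, _, hx⟩ := hx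
    obtain ⟨⟨hya, hyb, hyc⟩, _, hy⟩ := hy
    by_contra hxy
    exact htwo (pairVertex b x hxb.symm) (pairVertex c y hyc.symm)
      (pairVertex_adj.mpr ⟨hab, hxa.symm, hbc.symm, hxc.symm⟩)
      (pairVertex_adj.mpr ⟨hbc, hyb.symm, hxc, hxy⟩)
      (pairVertex_adj.mpr ⟨hac.symm, hbc.symm, hya, hyb⟩) hx hy
  set A : Finset (Fin m) := Finset.univ \ {a, b} with hAdef
  have hA : A.card = m - 2 := by
    rw [hAdef, Finset.card_univ_sdiff, Finset.card_pair hab, Fintype.card_fin]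
  have hsub : O ⊆ A.image (fun x => {a, x}) ∪ {{b, c}} ∪ (X.image (fun x => {b, x}) ∪
      Y.image (fun y => {c, y})) := by
    intro s hs
    obtain ⟨h2, hodd⟩ := (hmem s).mp hs
    simp only [Finset.mem_union, Finset.mem_image, Finset.mem_singleton]
    by_cases ha : a ∈ s
    · obtain ⟨x, hax, hx⟩ := exists_pairVertex ⟨s, h2⟩ ha
      have hs' : s = {a, x} := congrArg Subtype.val hx
      refine .inl (.inl ⟨x, ?_, hs'.symm⟩)
      have hxb : x ≠ b := by
        rintro rfl
        rw [hx, hr] at hodd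
        omega
      simp [hAdef, hax.symm, hxb]
    by_cases hb : b ∈ s
    · obtain ⟨x, hbx, hx⟩ := exists_pairVertex ⟨s, h2⟩ hb
      have hs' : s = {b, x} := congrArg Subtype.val hx
      by_cases hxc : x = c
      · exact .inl (.inr (hxc ▸ hs'))
      · refine .inr (.inl ⟨x, ?_, hs'.symm⟩)
        rw [hX, Finset.mem_filter, hWmem]
        refine ⟨⟨?_, hbx.symm, hxc⟩, hs' ▸ hs⟩
        rintro rfl
        simp [hs'] at ha
    by_cases hc : c ∈ s
    · obtain ⟨y, hcy, hy⟩ := exists_pairVertex ⟨s, h2⟩ hc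
      have hs' : s = {c, y} := congrArg Subtype.val hy
      refine .inr (.inr ⟨y, ?_, hs'.symm⟩)
      rw [hY, Finset.mem_filter, hWmem]
      refine ⟨⟨?_, ?_, hcy.symm⟩, hs' ▸ hs⟩
      · rintro rfl
        simp [hs'] at ha
      · rintro rfl
        simp [hs'] at hb
    · have := hone ⟨s, h2⟩ (by rw [kneserGraph_two_adj]; simp [pairVertex, ha, hc])
        (by rw [kneserGraph_two_adj]; simp [pairVertex, ha, hb])
      omega
  have h₁ := Finset.card_le_card hsub
  have h₂ := Finset.card_union_le (A.image (fun x => ({a, x} : Finset (Fin m))) ∪ {{b, c}})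
    (X.image (fun x => {b, x}) ∪ Y.image (fun y => {c, y}))
  have h₃ := Finset.card_union_le (A.image (fun x => ({a, x} : Finset (Fin m)))) {{b, c}}
  have h₄ := Finset.card_union_le (X.image (fun x => ({b, x} : Finset (Fin m))))
    (Y.image (fun y => {c, y}))
  have h₅ : (A.image (fun x => ({a, x} : Finset (Fin m)))).card ≤ _ := Finset.card_image_le
  have h₆ : (X.image (fun x => ({b, x} : Finset (Fin m)))).card ≤ _ := Finset.card_image_le
  have h₇ : (Y.image (fun y => ({c, y} : Finset (Fin m)))).card ≤ _ := Finset.card_image_le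
  rw [Finset.card_singleton] at h₃
  omega

lemma sum_eq_two_mul_add_card_odd {V : Type*} [Fintype V] (C : V → ℕ) :
    ∑ x, C x = 2 * ∑ x, C x / 2 + (Finset.univ.filter fun x => C x % 2 = 1).card := by
  rw [Finset.card_filter, Finset.mul_sum, ← Finset.sum_add_distrib]
  refine Finset.sum_congr rfl fun x _ => ?_
  split_ifs <;> omega

end Kneser

section Petersen

variable {a b c d e : Fin 5}

lemma sum_petersen_le (hnd : [a, b, c, d, e].Nodup)
    (hab : a ≠ b) (hac : a ≠ c) (had : a ≠ d) (hae : a ≠ e) (hbc : b ≠ c) (hbd : b ≠ d)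
    (hbe : b ≠ e) (hcd : c ≠ d) (hce : c ≠ e) (hde : d ≠ e)
    (f : {s : Finset (Fin 5) // s.card = 2} → ℕ) :
    ∑ x, f x ≤ f (pairVertex a b hab) + f (pairVertex a c hac) + f (pairVertex a d had) +
      f (pairVertex a e hae) + f (pairVertex b c hbc) + f (pairVertex b d hbd) +
      f (pairVertex b e hbe) + f (pairVertex c d hcd) + f (pairVertex c e hce) +
      f (pairVertex d e hde) := by
  have huniv : ∀ x : Fin 5, x = a ∨ x = b ∨ x = c ∨ x = d ∨ x = e := by
    have : [a, b, c, d, e].toFinset = Finset.univ := by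
      rw [← Finset.card_eq_iff_eq_univ, List.toFinset_card_of_nodup hnd]
      simp
    intro x
    have hx : x ∈ [a, b, c, d, e].toFinset := this ▸ Finset.mem_univ x
    simpa using hx
  set l : List {s : Finset (Fin 5) // s.card = 2} := [pairVertex a b hab, pairVertex a c hac,
    pairVertex a d had, pairVertex a e hae, pairVertex b c hbc, pairVertex b d hbd,
    pairVertex b e hbe, pairVertex c d hcd, pairVertex c e hce, pairVertex d e hde] with hl
  have hmem : ∀ x, x ∈ l := by
    intro x
    obtain ⟨y, z, hyz, hx⟩ := Finset.card_eq_two.mp x.2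
    obtain rfl : x = pairVertex y z hyz := Subtype.ext hx
    rw [hl]
    rcases huniv y with rfl | rfl | rfl | rfl | rfl <;>
      rcases huniv z with rfl | rfl | rfl | rfl | rfl <;>
      first
      | exact absurd rfl hyz
      | (simp; done)
      | (rw [pairVertex_comm hyz]; simp)
  have hsub : (Finset.univ : Finset {s : Finset (Fin 5) // s.card = 2}).val ≤ (l : Multiset _) :=
    Multiset.le_iff_subset Finset.univ.nodup |>.mpr fun x _ => hmem x
  obtain ⟨k, hk⟩ := Multiset.le_iff_exists_add.mp hsub
  have hsum : (l.map f).sum = ∑ x, f x + (k.map f).sum := by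
    rw [Finset.sum, ← Multiset.sum_add, ← Multiset.map_add, ← hk]
    simp
  simp only [hl, List.map_cons, List.map_nil, List.sum_cons, List.sum_nil] at hsum
  omega

lemma ne_of_nodup (hnd : [a, b, c, d, e].Nodup) :
    (a ≠ b ∧ a ≠ c ∧ a ≠ d ∧ a ≠ e) ∧ (b ≠ c ∧ b ≠ d ∧ b ≠ e) ∧ (c ≠ d ∧ c ≠ e) ∧ d ≠ e := by
  simpa using hnd

/-- Pairs on two nonadjacent vertices of the Petersen graph with no common neighbor next to
`{a, b}`. -/
lemma not_two_le_of_nonadj (hnd : [a, b, c, d, e].Nodup)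
    (hab : a ≠ b) (hac : a ≠ c) (had : a ≠ d)
    {C : {s : Finset (Fin 5) // s.card = 2} → ℕ} (hsum : 9 ≤ ∑ x, C x)
    (h : ∀ E ≤ C, ¬ Solvable (kneserGraph 5 2) E (Pi.single (pairVertex a b hab) 1))
    (h₁ : 2 ≤ C (pairVertex a c hac)) : C (pairVertex a d had) ≤ 1 := by
  by_contra! h₂
  obtain ⟨⟨-, -, -, hae⟩, ⟨hbc, hbd, hbe⟩, ⟨hcd, hce⟩, hde⟩ := ne_of_nodup hnd
  have hle := sum_petersen_le hnd hab hac had hae hbc hbd hbe hcd hce hde C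
  have hab0 : C (pairVertex a b hab) < 1 := lt_of_unsolvable_single h (solvable_of_le le_rfl)
  have hac3 : C (pairVertex a c hac) < 4 := by
    apply lt_of_unsolvable_single h
      (solvable_single_four (w := pairVertex d e hde) _ _) <;> grind [pairVertex_adj]
  have had3 : C (pairVertex a d had) < 4 := by
    apply lt_of_unsolvable_single h
      (solvable_single_four (w := pairVertex c e hce) _ _) <;> grind [pairVertex_adj]
  have hae1 : C (pairVertex a e hae) < 2 := by
    apply lt_of_unsolvable_triple h h₁ h₂ (solvable_join_join
      (u := pairVertex b d hbd) (w := pairVertex c e hce) _ _ _ _ _) <;>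
      grind [pairVertex_adj, pairVertex_inj]
  have hbc0 : C (pairVertex b c hbc) < 1 := by
    apply lt_of_unsolvable_triple h h₂ h₁ (solvable_relay_join
      (w := pairVertex d e hde) _ _ _ _) <;> grind [pairVertex_adj, pairVertex_inj]
  have hbd0 : C (pairVertex b d hbd) < 1 := by
    apply lt_of_unsolvable_triple h h₁ h₂ (solvable_relay_join
      (w := pairVertex c e hce) _ _ _ _) <;> grind [pairVertex_adj, pairVertex_inj]
  have hbe1 : C (pairVertex b e hbe) < 2 := by
    apply lt_of_unsolvable_triple h h₁ h₂ (solvable_two_two_two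
      (w := pairVertex c d hcd) _ _ _ _) <;> grind [pairVertex_adj, pairVertex_inj]
  have hcd0 : C (pairVertex c d hcd) < 1 := by
    apply lt_of_unsolvable_triple h h₁ h₂ (solvable_join_relay
      (u := pairVertex b e hbe) _ _ _ _) <;> grind [pairVertex_adj, pairVertex_inj]
  have hce0 : C (pairVertex c e hce) < 1 := by
    apply lt_of_unsolvable_pair h h₂ (solvable_relay _ _) <;>
      grind [pairVertex_adj, pairVertex_inj]
  have hde0 : C (pairVertex d e hde) < 1 := by
    apply lt_of_unsolvable_pair h h₁ (solvable_relay _ _) <;>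
      grind [pairVertex_adj, pairVertex_inj]
  omega

/-- Pairs on two adjacent vertices of the Petersen graph, both at distance two from `{a, b}`. -/
lemma not_two_le_of_adj (hnd : [a, b, c, d, e].Nodup)
    (hab : a ≠ b) (hac : a ≠ c) (hbd : b ≠ d)
    {C : {s : Finset (Fin 5) // s.card = 2} → ℕ} (hsum : 9 ≤ ∑ x, C x)
    (h : ∀ E ≤ C, ¬ Solvable (kneserGraph 5 2) E (Pi.single (pairVertex a b hab) 1))
    (h₁ : 2 ≤ C (pairVertex a c hac)) : C (pairVertex b d hbd) ≤ 1 := by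
  by_contra! h₂
  obtain ⟨⟨-, -, had, hae⟩, ⟨hbc, -, hbe⟩, ⟨hcd, hce⟩, hde⟩ := ne_of_nodup hnd
  have hle := sum_petersen_le hnd hab hac had hae hbc hbd hbe hcd hce hde C
  have h' : ∀ E ≤ C, ¬ Solvable (kneserGraph 5 2) E (Pi.single (pairVertex b a hab.symm) 1) := by
    rwa [← pairVertex_comm hab]
  have hab0 : C (pairVertex a b hab) < 1 := lt_of_unsolvable_single h (solvable_of_le le_rfl)
  have hac2 : C (pairVertex a c hac) < 3 := by
    apply lt_of_unsolvable_pair h h₂ (solvable_two_three (w := pairVertex d e hde) _ _ _) <;>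
      grind [pairVertex_adj, pairVertex_inj]
  have hbd2 : C (pairVertex b d hbd) < 3 := by
    apply lt_of_unsolvable_pair h h₁ (solvable_two_three (w := pairVertex c e hce) _ _ _) <;>
      grind [pairVertex_adj, pairVertex_inj]
  have had1 : C (pairVertex a d had) ≤ 1 := not_two_le_of_nonadj hnd hab hac had hsum h h₁
  have hae1 : C (pairVertex a e hae) ≤ 1 :=
    not_two_le_of_nonadj (c := c) (e := d) (by grind) hab hac hae hsum h h₁
  have hbc1 : C (pairVertex b c hbc) ≤ 1 :=
    not_two_le_of_nonadj (c := d) (e := e) (by grind) hab.symm hbd hbc hsum h' h₂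
  have hbe1 : C (pairVertex b e hbe) ≤ 1 :=
    not_two_le_of_nonadj (c := d) (e := c) (by grind) hab.symm hbd hbe hsum h' h₂
  have hcd1 : C (pairVertex c d hcd) < 2 := by
    apply lt_of_unsolvable_single h (solvable_single (k := 1) _)
    grind [pairVertex_adj]
  have hce0 : C (pairVertex c e hce) < 1 := by
    apply lt_of_unsolvable_pair h h₂ (solvable_relay _ _) <;>
      grind [pairVertex_adj, pairVertex_inj]
  have hde0 : C (pairVertex d e hde) < 1 := by
    apply lt_of_unsolvable_pair h h₁ (solvable_relay _ _) <;>
      grind [pairVertex_adj, pairVertex_inj]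
  have hbecd : 1 ≤ C (pairVertex b e hbe) → C (pairVertex c d hcd) < 1 := fun hbe1 => by
    apply lt_of_unsolvable_triple h h₁ hbe1 (solvable_relay_relay _ _ _) <;>
      grind [pairVertex_adj, pairVertex_inj]
  omega

end Petersen
section UpperBound

lemma exists_second_pair {V : Type*} [Fintype V] [DecidableEq V] {C : V → ℕ} {v : V}
    (hv : C v ≤ 3) (hpairs : 2 ≤ ∑ x, C x / 2) : ∃ v', v' ≠ v ∧ 2 ≤ C v' := by
  by_contra! hno
  rw [← Finset.add_sum_erase _ _ (Finset.mem_univ v), Finset.sum_eq_zero] at hpairs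
  · omega
  · intro x hx
    have := hno x (Finset.ne_of_mem_erase hx)
    omega

lemma petersen_names {a b c d : Fin 5} (h : [a, b, c, d].Nodup) :
    ∃ e, [a, b, c, d, e].Nodup := by
  obtain ⟨e, he⟩ : ∃ e, e ∉ ({a, b, c, d} : Finset (Fin 5)) := by
    by_contra! hall
    have h₁ := Finset.card_le_card (fun x _ => hall x : Finset.univ ⊆ ({a, b, c, d} : Finset (Fin 5)))
    have h₂ : ({a, b, c, d} : Finset (Fin 5)).card ≤ 4 := Finset.card_le_four
    simp at h₁
    omega
  refine ⟨e, ?_⟩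
  simp at he
  grind

/-- In the Petersen graph, once one unit of demand on `r` cannot be served cheaply there are at
most three pairs left, and then nine pebbles suffice to serve it. -/
lemma petersen_stuck {C : {s : Finset (Fin 5) // s.card = 2} → ℕ}
    {r v v' : {s : Finset (Fin 5) // s.card = 2}} (hr : C r = 0) (hle : ∀ x, C x ≤ 3)
    (hadj : ∀ w, (kneserGraph 5 2).Adj w r → C w ≤ 1)
    (hjoin : ∀ x y w, x ≠ y → 2 ≤ C x → 2 ≤ C y → (kneserGraph 5 2).Adj x w →
      (kneserGraph 5 2).Adj y w → ¬ (kneserGraph 5 2).Adj w r)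
    (hne : v' ≠ v) (hv : 2 ≤ C v) (hv' : 2 ≤ C v') (hsum : 9 ≤ ∑ x, C x) :
    ∑ x, C x / 2 ≤ 3 ∧ ∃ E ≤ C, Solvable (kneserGraph 5 2) E (Pi.single r 1) := by
  have hfar : ∀ x, 2 ≤ C x → x ≠ r ∧ ¬ (kneserGraph 5 2).Adj x r := fun x hx =>
    ⟨by rintro rfl; omega, fun h => by have := hadj x h; omega⟩
  obtain ⟨a, b, c, hab, hac, hbc, rfl, rfl⟩ :=
    exists_pairVertex_pairVertex (hfar v hv).1 (hfar v hv).2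
  obtain ⟨y, z, d, hyz, hyd, hzd, hyzab, rfl⟩ :=
    exists_pairVertex_pairVertex (hfar v' hv').1 (hfar v' hv').2
  rw [pairVertex_inj] at hyzab
  have hcd : c ≠ d := by
    rintro rfl
    obtain ⟨w, hw⟩ := exists_pairVertex_of_card (m := 5) (s := {a, b, c}) (by
      have : ({a, b, c} : Finset (Fin 5)).card ≤ 3 := Finset.card_le_three
      omega)
    simp only [Finset.disjoint_insert_right, Finset.disjoint_singleton_right] at hw
    refine hjoin _ _ w hne hv' hv ?_ ?_ ?_ <;> rw [kneserGraph_two_adj] <;> simp [pairVertex] <;>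
      grind
  have hnd : [a, b, c, d].Nodup := by simp; grind
  obtain ⟨e, hnd⟩ := petersen_names hnd
  obtain ⟨⟨-, -, had, hae⟩, ⟨-, hbd, hbe⟩, ⟨-, hce⟩, hde⟩ := ne_of_nodup hnd
  constructor
  · have hle10 := sum_petersen_le hnd hab hac had hae hbc hbd hbe hcd hce hde fun x => C x / 2
    have h₁ := hadj (pairVertex c d hcd) (by grind [pairVertex_adj])
    have h₂ := hadj (pairVertex c e hce) (by grind [pairVertex_adj])
    have h₃ := hadj (pairVertex d e hde) (by grind [pairVertex_adj])
    have hc : ¬ (2 ≤ C (pairVertex a c hac) ∧ 2 ≤ C (pairVertex b c hbc)) := fun h => by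
      apply hjoin _ _ (pairVertex d e hde) _ h.1 h.2 <;> grind [pairVertex_adj, pairVertex_inj]
    have hd : ¬ (2 ≤ C (pairVertex a d had) ∧ 2 ≤ C (pairVertex b d hbd)) := fun h => by
      apply hjoin _ _ (pairVertex c e hce) _ h.1 h.2 <;> grind [pairVertex_adj, pairVertex_inj]
    have he : ¬ (2 ≤ C (pairVertex a e hae) ∧ 2 ≤ C (pairVertex b e hbe)) := fun h => by
      apply hjoin _ _ (pairVertex c d hcd) _ h.1 h.2 <;> grind [pairVertex_adj, pairVertex_inj]
    have := hle (pairVertex a c hac)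
    have := hle (pairVertex a d had)
    have := hle (pairVertex a e hae)
    have := hle (pairVertex b c hbc)
    have := hle (pairVertex b d hbd)
    have := hle (pairVertex b e hbe)
    omega
  · by_contra! h
    rcases hyzab with ⟨rfl, rfl⟩ | ⟨rfl, rfl⟩
    · have := not_two_le_of_nonadj hnd hab hac had hsum h hv
      omega
    · have := not_two_le_of_adj hnd hab hac hbd hsum h hv
      omega

/-- With one pair available per unit of demand, `4 |D| + 2 m - 5` pebbles suffice. -/
lemma solvable_of_card_le_pairs {m : ℕ} (hm : 5 ≤ m) (t : ℕ)
    (C D : {s : Finset (Fin m) // s.card = 2} → ℕ) (hD : ∑ x, D x = t)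
    (hpairs : t ≤ ∑ x, C x / 2) (hsize : 4 * t + 2 * m ≤ ∑ x, C x + 5) :
    Solvable (kneserGraph m 2) C D := by
  induction t generalizing C D with
  | zero =>
    refine solvable_of_le fun x => ?_
    have := Finset.single_le_sum (f := D) (fun _ _ => Nat.zero_le _) (Finset.mem_univ x)
    exact (this.trans hD.le).trans (Nat.zero_le _)
  | succ t ih =>
    by_contra hns
    obtain ⟨r, -, hDr⟩ := Finset.exists_ne_zero_of_sum_ne_zero (by omega : ∑ x, D x ≠ 0)
    have hDr : 1 ≤ D r := by omega
    have hD' : ∑ x, (D - Pi.single r 1 : _ → ℕ) x = t := by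
      have := sum_sub_single hDr
      omega
    have hdeliver : ∀ E F : {s : Finset (Fin m) // s.card = 2} → ℕ, E ≤ C →
        Solvable (kneserGraph m 2) E (Pi.single r 1) → ∑ x, E x ≤ 4 →
        (∀ x, C x / 2 ≤ (C x - E x) / 2 + F x) → t + ∑ x, F x ≤ ∑ x, C x / 2 → False := by
      intro E F hE hs hEsum hF hFsum
      refine hns (solvable_of_deliver hE hs hDr (ih _ _ hD' ?_ ?_))
      · have := Finset.sum_le_sum fun x (_ : x ∈ Finset.univ) => hF x
        rw [Finset.sum_add_distrib] at this
        simp only [Pi.sub_apply]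
        omega
      · have : ∑ x, (C - E + E : _ → ℕ) x = ∑ x, C x := by rw [tsub_add_cancel_of_le hE]
        simp only [Pi.add_apply, Finset.sum_add_distrib] at this
        omega
    have hr : C r = 0 := by
      by_contra hCr
      refine hdeliver (Pi.single r 1) (Pi.single r 1) (single_le_config (by omega))
        (solvable_of_le le_rfl) (by simp) (fun x => ?_) (by simpa)
      simp only [Pi.single_apply]
      split_ifs <;> omega
    have hadj : ∀ w, (kneserGraph m 2).Adj w r → C w ≤ 1 := by
      intro w hw
      by_contra! hCw
      refine hdeliver (Pi.single w 2) (Pi.single w 1) (single_le_config (by omega))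
        (solvable_single hw 1) (by simp) (fun x => ?_) (by simpa)
      simp only [Pi.single_apply]
      split_ifs <;> omega
    have hfar : ∀ x, 2 ≤ C x → x ≠ r ∧ ¬ (kneserGraph m 2).Adj x r := fun x hx =>
      ⟨by rintro rfl; omega, fun h => by have := hadj x h; omega⟩
    obtain ⟨v, hv⟩ : ∃ v, 2 ≤ C v := by
      obtain ⟨v, -, hv⟩ := Finset.exists_ne_zero_of_sum_ne_zero (by omega : ∑ x, C x / 2 ≠ 0)
      exact ⟨v, by omega⟩
    have hone : ∀ w, (kneserGraph m 2).Adj v w → (kneserGraph m 2).Adj w r → C w = 0 := by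
      intro w hvw hwr
      by_contra hCw
      have := hadj w hwr
      refine hdeliver (Pi.single v 2 + Pi.single w 1) (Pi.single v 1)
        (single_add_single_le hvw.ne (by omega) (by omega)) (solvable_relay hvw hwr)
        (by simp [Finset.sum_add_distrib]) (fun x => ?_) (by simpa)
      simp only [Pi.add_apply, Pi.single_apply]
      split_ifs <;> subst_vars <;> omega
    have htwo : ∀ u w, (kneserGraph m 2).Adj v u → (kneserGraph m 2).Adj u w →
        (kneserGraph m 2).Adj w r → C u % 2 = 1 → C w % 2 = 1 → False := by
      intro u w hvu huw hwr hu hw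
      have hvw : v ≠ w := by rintro rfl; exact (hfar _ hv).2 hwr
      refine hdeliver (Pi.single v 2 + Pi.single u 1 + Pi.single w 1) (Pi.single v 1)
        (single_add_single_add_single_le hvu.ne hvw huw.ne (by omega) (by omega) (by omega))
        (solvable_relay_relay hvu huw hwr) (by simp [Finset.sum_add_distrib]) (fun x => ?_) (by simpa)
      have := hvu.ne
      have := huw.ne
      simp only [Pi.add_apply, Pi.single_apply]
      split_ifs <;> subst_vars <;> first | omega | contradiction
    have hodd := card_odd_le hm (hfar v hv).1 (hfar v hv).2 hr hone htwo
    have hsplit := sum_eq_two_mul_add_card_odd C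
    have hpairs : 2 * (t + 1) ≤ ∑ x, C x / 2 := by omega
    have hmeet : ∀ x, 2 ≤ C x → (x.1 \ r.1).card ≤ 1 := by
      intro x hx
      have h := (hfar x hx).2
      rw [kneserGraph_two_adj, Finset.disjoint_iff_inter_eq_empty, ← Finset.card_eq_zero] at h
      have := Finset.card_sdiff_add_card_inter x.1 r.1
      have := x.2
      omega
    have hjoin : ∀ x y w, x ≠ y → 2 ≤ C x → 2 ≤ C y → (kneserGraph m 2).Adj x w →
        (kneserGraph m 2).Adj y w → ¬ (kneserGraph m 2).Adj w r := by
      intro x y w hxy hx hy hxw hyw hwr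
      refine hdeliver (Pi.single x 2 + Pi.single y 2) (Pi.single x 1 + Pi.single y 1)
        (single_add_single_le hxy hx hy) (solvable_join hxw hyw hwr)
        (by simp [Finset.sum_add_distrib]) (fun z => ?_)
        (by simp [Finset.sum_add_distrib]; omega)
      simp only [Pi.add_apply, Pi.single_apply]
      split_ifs <;> omega
    have hthree : ∀ x, C x ≤ 3 := by
      intro x
      by_contra! hx
      obtain ⟨w, hw⟩ := exists_pairVertex_of_card (s := r.1 ∪ (x.1 \ r.1)) (by
        have := Finset.card_union_le r.1 (x.1 \ r.1)
        have := hmeet x (by omega)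
        have := r.2
        omega)
      rw [Finset.union_sdiff_self_eq_union, Finset.disjoint_union_right] at hw
      refine hdeliver (Pi.single x 4) (Pi.single x 2) (single_le_config hx)
        (solvable_single_four (w := w) ?_ ?_) (by simp) (fun z => ?_) (by simp; omega)
      · exact kneserGraph_two_adj.mpr hw.2.symm
      · exact kneserGraph_two_adj.mpr hw.1
      · simp only [Pi.single_apply]
        split_ifs <;> omega
    obtain ⟨v', hne, hv'⟩ := exists_second_pair (hthree v) (by omega)
    rcases hm.eq_or_lt with rfl | hm6
    · obtain ⟨hfew, E, hE, hs⟩ :=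
        petersen_stuck hr hthree hadj hjoin hne hv hv' (by omega)
      refine hns (solvable_of_deliver hE hs hDr (solvable_of_le fun x => ?_))
      have := Finset.single_le_sum (f := (D - Pi.single r 1 : _ → ℕ)) (fun _ _ => Nat.zero_le _)
        (Finset.mem_univ x)
      exact (this.trans (by omega : _ ≤ 0)).trans (Nat.zero_le _)
    · obtain ⟨w, hw⟩ := exists_pairVertex_of_card (s := r.1 ∪ (v.1 \ r.1 ∪ v'.1 \ r.1)) (by
        have := Finset.card_union_le r.1 (v.1 \ r.1 ∪ v'.1 \ r.1)
        have := Finset.card_union_le (v.1 \ r.1) (v'.1 \ r.1)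
        have := hmeet v hv
        have := hmeet v' hv'
        have := r.2
        omega)
      rw [← Finset.union_sdiff_distrib, Finset.union_sdiff_self_eq_union,
        Finset.disjoint_union_right, Finset.disjoint_union_right] at hw
      exact hjoin v' v w hne hv' hv (kneserGraph_two_adj.mpr hw.2.2.symm)
        (kneserGraph_two_adj.mpr hw.2.1.symm) (kneserGraph_two_adj.mpr hw.1)

/-- The upper bound `max (n + 2 t - 2) (4 t + 2 m - 5)` for every demand of size `t`, where `n` is
the number of vertices of `K(m, 2)`. -/
lemma solvable_of_size {m : ℕ} (hm : 5 ≤ m) (t : ℕ)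
    (C D : {s : Finset (Fin m) // s.card = 2} → ℕ) (hD : ∑ x, D x = t)
    (hcard : Fintype.card {s : Finset (Fin m) // s.card = 2} + 2 * t ≤ ∑ x, C x + 2)
    (hsize : 4 * t + 2 * m ≤ ∑ x, C x + 5) : Solvable (kneserGraph m 2) C D := by
  induction t generalizing C D with
  | zero =>
    refine solvable_of_le fun x => ?_
    have := Finset.single_le_sum (f := D) (fun _ _ => Nat.zero_le _) (Finset.mem_univ x)
    exact (this.trans hD.le).trans (Nat.zero_le _)
  | succ t ih =>
    by_cases hoverlap : ∃ r, 1 ≤ D r ∧ 1 ≤ C r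
    · obtain ⟨r, hDr, hCr⟩ := hoverlap
      have hD' := sum_sub_single hDr
      have hC' := sum_sub_single hCr
      exact solvable_of_deliver (single_le_config hCr) (solvable_of_le le_rfl) hDr
        (ih _ _ (by omega) (by omega) (by omega))
    · push Not at hoverlap
      obtain ⟨r, -, hDr⟩ := Finset.exists_ne_zero_of_sum_ne_zero (by omega : ∑ x, D x ≠ 0)
      have hCr := hoverlap r (by omega)
      refine solvable_of_card_le_pairs hm (t + 1) C D hD ?_ hsize
      have hsplit := sum_eq_two_mul_add_card_odd C
      have hlt : (Finset.univ.filter fun x => C x % 2 = 1).card <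
          Fintype.card {s : Finset (Fin m) // s.card = 2} := by
        rw [Fintype.card]
        refine Finset.card_lt_card (Finset.filter_ssubset.mpr ⟨r, Finset.mem_univ r, ?_⟩)
        omega
      omega

end UpperBound

section KneserLowerBound

variable {m t : ℕ} {r v : {s : Finset (Fin m) // s.card = 2}}

lemma card_le_pebblingNumber_stack (ht : 1 ≤ t) (hrv : v ≠ r) {L : ℕ}
    (hL : ∀ C, ∑ x, C x = L → Solvable (kneserGraph m 2) C (stack r t)) :
    Fintype.card {s : Finset (Fin m) // s.card = 2} + 2 * t ≤
      pebblingNumber (kneserGraph m 2) (stack r t) + 2 := by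
  set C₀ : {s : Finset (Fin m) // s.card = 2} → ℕ :=
    fun x => if x = r then 0 else if x = v then 2 * t - 1 else 1 with hC₀
  have hsum : ∑ x, C₀ x + 1 = Fintype.card {s : Finset (Fin m) // s.card = 2} + (2 * t - 2) := by
    have : ∀ x, C₀ x + (Pi.single r 1 : _ → ℕ) x = 1 + (Pi.single v (2 * t - 2) : _ → ℕ) x := by
      intro x
      simp only [hC₀, Pi.single_apply]
      split_ifs <;> subst_vars <;> first | omega | contradiction
    have := Finset.sum_congr rfl fun x (_ : x ∈ Finset.univ) => this x
    simpa [Finset.sum_add_distrib] using this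
  have hlt := lt_pebblingNumber_of_forall_le (C₀ := C₀) hL fun C hC =>
    not_solvable_stack_of_weight (g := fun x c => if x = r then c else c / 2)
      (fun x a b hab => by dsimp only; split_ifs <;> omega)
      (fun x y hxy c d => by
        have := hxy.ne
        split_ifs <;> subst_vars <;> omega) hC (by
        have : ∀ x, (if x = r then C₀ x else C₀ x / 2) = (Pi.single v (t - 1) : _ → ℕ) x := by
          intro x
          simp only [hC₀, Pi.single_apply]
          split_ifs <;> subst_vars <;> first | omega | contradiction
        rw [Finset.sum_congr rfl fun x _ => this x]
        simp
        omega)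
  omega

open Classical in
lemma card_not_adj_ge (hm : 2 ≤ m) (r : {s : Finset (Fin m) // s.card = 2}) :
    2 * m ≤ (Finset.univ.filter fun x => x ≠ r ∧ ¬ (kneserGraph m 2).Adj r x).card + 4 := by
  obtain ⟨a, b, hab, hr⟩ := Finset.card_eq_two.mp r.2
  obtain rfl : r = pairVertex a b hab := Subtype.ext hr
  set W : Finset (Fin m) := Finset.univ \ {a, b} with hWdef
  have hW : W.card = m - 2 := by
    rw [hWdef, Finset.card_univ_sdiff, Finset.card_pair hab, Fintype.card_fin]
  have hWa : ∀ x : W, a ≠ x := fun x h => by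
    have := x.2
    simp [hWdef, ← h] at this
  have hWb : ∀ x : W, b ≠ x := fun x h => by
    have := x.2
    simp [hWdef, ← h] at this
  have hcard := Finset.card_le_card_of_injOn (s := Finset.univ)
    (t := Finset.univ.filter fun x => x ≠ pairVertex a b hab ∧
      ¬ (kneserGraph m 2).Adj (pairVertex a b hab) x)
    (Sum.elim (fun x : W => pairVertex a x (hWa x)) (fun x : W => pairVertex b x (hWb x)))
    (by
      rintro (x | x) -
      · have := hWb x
        simp [pairVertex_adj, pairVertex_inj]
        grind
      · have := hWa x
        simp [pairVertex_adj, pairVertex_inj]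
        grind)
    (by
      rintro (x | x) - (y | y) - h
      · simp only [Sum.elim_inl, pairVertex_inj] at h
        grind
      · simp only [Sum.elim_inl, Sum.elim_inr, pairVertex_inj] at h
        grind
      · simp only [Sum.elim_inl, Sum.elim_inr, pairVertex_inj] at h
        grind
      · simp only [Sum.elim_inr, pairVertex_inj] at h
        grind)
  simp only [Finset.card_univ, Fintype.card_sum, Fintype.card_coe, hW] at hcard
  omega

lemma four_mul_le_pebblingNumber_stack (hm : 2 ≤ m) (ht : 1 ≤ t) (hrv : v ≠ r)
    (hadj : ¬ (kneserGraph m 2).Adj r v) {L : ℕ}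
    (hL : ∀ C, ∑ x, C x = L → Solvable (kneserGraph m 2) C (stack r t)) :
    4 * t + 2 * m ≤ pebblingNumber (kneserGraph m 2) (stack r t) + 5 := by
  classical
  set C₀ : {s : Finset (Fin m) // s.card = 2} → ℕ :=
    fun x => (if x ≠ r ∧ ¬ (kneserGraph m 2).Adj r x then 1 else 0) +
      (Pi.single v (4 * t - 2) : _ → ℕ) x with hC₀
  have hsum : 4 * t + 2 * m ≤ ∑ x, C₀ x + 6 := by
    have := card_not_adj_ge hm r
    simp only [hC₀, Finset.sum_add_distrib, ← Finset.card_filter, Finset.sum_pi_single',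
      Finset.mem_univ, if_true]
    omega
  have hlt := lt_pebblingNumber_of_forall_le (C₀ := C₀) hL fun C hC =>
    not_solvable_stack_of_weight
      (g := fun x c => if x = r then 4 * c else if (kneserGraph m 2).Adj r x then 2 * c
        else 2 * (c / 2))
      (fun x a b hab => by dsimp only; split_ifs <;> omega)
      (fun x y hxy c d => by
        have := hxy.symm
        split_ifs <;> subst_vars <;> first | omega | contradiction) hC (by
        have : ∀ x, (if x = r then 4 * C₀ x else if (kneserGraph m 2).Adj r x then 2 * C₀ x
            else 2 * (C₀ x / 2)) = (Pi.single v (4 * t - 2) : _ → ℕ) x := by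
          intro x
          simp only [hC₀, Pi.single_apply]
          by_cases hxv : x = v
          · subst hxv
            simp [hrv, hadj]
            omega
          · by_cases hxr : x = r
            · simp [hxr, hrv.symm]
            · by_cases hx : (kneserGraph m 2).Adj r x <;> simp [hx, hxr, hxv]
        rw [Finset.sum_congr rfl fun x _ => this x]
        simp
        omega)
  omega

end KneserLowerBound

theorem kneser_target_conjecture (m : ℕ) (hm : 5 ≤ m)
    (D : {s : Finset (Fin m) // s.card = 2} → ℕ)
    (t : ℕ) (ht : 1 ≤ t) (hD : ∑ v, D v = t) :
    pebblingNumber (kneserGraph m 2) D ≤ tPebblingNumber (kneserGraph m 2) t := by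
  have h01 : (⟨0, by omega⟩ : Fin m) ≠ ⟨1, by omega⟩ := by simp
  have h02 : (⟨0, by omega⟩ : Fin m) ≠ ⟨2, by omega⟩ := by simp
  set r := pairVertex _ _ h01 with hr
  set v := pairVertex _ _ h02 with hv
  have hvr : v ≠ r := by simp [hr, hv, pairVertex_inj]
  have hadj : ¬ (kneserGraph m 2).Adj r v := by simp [hr, hv, pairVertex_adj]
  set L := max (Fintype.card {s : Finset (Fin m) // s.card = 2} + 2 * t - 2) (4 * t + 2 * m - 5)
    with hLdef
  have hL : ∀ D : {s : Finset (Fin m) // s.card = 2} → ℕ, ∑ x, D x = t →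
      ∀ C, ∑ x, C x = L → Solvable (kneserGraph m 2) C D := fun D hD C hC =>
    solvable_of_size hm t C D hD (by omega) (by omega)
  have hLr := hL (stack r t) (by simp [stack])
  have h₁ := card_le_pebblingNumber_stack ht hvr hLr
  have h₂ := four_mul_le_pebblingNumber_stack (by omega) ht hvr hadj hLr
  calc pebblingNumber (kneserGraph m 2) D ≤ L := Nat.sInf_le (hL D hD)
    _ ≤ pebblingNumber (kneserGraph m 2) (stack r t) := by omega
    _ ≤ tPebblingNumber (kneserGraph m 2) t :=
      Finset.le_sup (f := fun r => pebblingNumber (kneserGraph m 2) (stack r t))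
        (Finset.mem_univ r)
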